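/- Let S = (X_0,…,X_{d−1}) be a d-symbol, ℓ ≥ 1, e ∈ {0,…,d−1}, and let σ = σ_{d,ℓ,e} be the permutation of ℕ with σ(r(dℓ) + sd + t) = r(dℓ) + sd + ((t + re) mod d), and σ(S) = s_d(σ(s_d^{-1}(S))). Let C = C_{(ℓ,e)}(S) = s_d(σ^{-1}(s_d^{-1}(C_{(ℓ)}(σ(S))))) be the (ℓ,e)-core of S, Q = Q_{ℓ,e}(S) = Q(σ(S)_{*ℓ}) the balanced (ℓ,e)-quotient of S, and δ = δ_{ℓ,σ(S)} the dℓ-hook data tuple with multiplier ℓ whose entry in position sd + i is s + ℓ·x_{i,s}, where x_{i,s} is the number of elements of the i-th β-set of σ(S) congruent to s modulo ℓ. Then there is a multiset equality 𝓗_{>0}(S) = abs(𝓗_{>0}^δ(Q)) ∪ 𝓗_{>0}(C), where 𝓗_{>0}(T) is the multiset of lengths a−b of the long hooks (a > b) of a symbol T, abs(𝓗_{>0}^δ(Q)) is the multiset of the nonzero values |h^δ(z)| over hooks z of Q, and ∪ is multiset union (sum). -/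

import Mathlib

/-- `X^{+s} = (X + s) ∪ {0,…,s−1}` for a β-set `X`. -/
def shiftUp (X : Finset ℕ) (s : ℕ) : Finset ℕ :=
  X.image (· + s) ∪ Finset.range s

/-- The `d`-symbol `s_d(X)` associated to a β-set `X`:
`X_i^{(d)} = {k ∈ ℕ : i + k*d ∈ X}`. -/
def sd (d : ℕ) (X : Finset ℕ) : Fin d → Finset ℕ :=
  fun i => (X.filter fun a => a % d = (i : ℕ)).image fun a => a / d

/-- The inverse of `s_d`, recovering the β-set of a `d`-symbol. -/
def sdInv (d : ℕ) (S : Fin d → Finset ℕ) : Finset ℕ :=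
  Finset.univ.biUnion fun i => (S i).image fun k => (i : ℕ) + k * d

/-- Hooks of a β-set `X`: pairs `(a,b)` with `a > b`, `a ∈ X`, `b ∉ X`. -/
def betaHooks (X : Finset ℕ) : Finset (ℕ × ℕ) :=
  (X ×ˢ Finset.range (X.sup id + 1)).filter fun p => p.2 < p.1 ∧ p.2 ∉ X

/-- Hooks of a `d`-symbol `S`: quadruples `(a,b,i,j)` with `a ∈ S i`, `b ∉ S j`,
and either `a > b`, or `a = b` and `i > j`. -/
def symbolHooks {d : ℕ} (S : Fin d → Finset ℕ) : Finset (ℕ × ℕ × Fin d × Fin d) :=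
  (Finset.range ((Finset.univ.sup fun i => (S i).sup id) + 1) ×ˢ
      Finset.range ((Finset.univ.sup fun i => (S i).sup id) + 1) ×ˢ
      (Finset.univ : Finset (Fin d)) ×ˢ (Finset.univ : Finset (Fin d))).filter
    fun z => z.1 ∈ S z.2.2.1 ∧ z.2.1 ∉ S z.2.2.2 ∧
      (z.2.1 < z.1 ∨ (z.1 = z.2.1 ∧ z.2.2.2 < z.2.2.1))

/-- The partition `p(X)` of a β-set `X = {a_1 > … > a_t}`, as the multiset of the
nonzero numbers among `a_i − (t−i)`; the element `a` contributes the part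
`a − #{b ∈ X : b < a}`. -/
def partitionOf (X : Finset ℕ) : Multiset ℕ :=
  Multiset.filter (· ≠ 0) (X.val.map fun a => a - (X.filter (· < a)).card)

/-- `r`, the maximal number of parts among the partitions `p(X_i)` of a `d`-symbol. -/
def quotCard {d : ℕ} (S : Fin d → Finset ℕ) : ℕ :=
  Finset.univ.sup fun i => Multiset.card (partitionOf (S i))

/-- `Y` is the balanced quotient `Q(S)` of `S`: each `Y i` is the (unique) β-set of
cardinality `r` with `p(Y i) = p(S i)`, where `r` is the maximal number of parts
among the `p(S i)`. -/
def IsBalancedQuotient {d : ℕ} (S Y : Fin d → Finset ℕ) : Prop :=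
  ∀ i, (Y i).card = quotCard S ∧ partitionOf (Y i) = partitionOf (S i)

/-- The core `C(S) = ([x_0],…,[x_{d−1}])` of a `d`-symbol, `x_i = |X_i|`. -/
def coreSymbol {d : ℕ} (S : Fin d → Finset ℕ) : Fin d → Finset ℕ :=
  fun i => Finset.range (S i).card

/-- The `δ`-length `k(a−b) + c_i − c_j` of a hook `(a,b,i,j)`, for the
`d`-hook data tuple `δ = (c_0,…,c_{d−1};k)`. -/
noncomputable def hookLen {d : ℕ} (c : Fin d → ℝ) (k : ℝ)
    (z : ℕ × ℕ × Fin d × Fin d) : ℝ :=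
  k * ((z.1 - z.2.1 : ℕ) : ℝ) + c z.2.2.1 - c z.2.2.2

/-- The multiset `𝓗^δ(S)` of `δ`-lengths of all hooks of `S`. -/
noncomputable def hookLens {d : ℕ} (c : Fin d → ℝ) (k : ℝ)
    (S : Fin d → Finset ℕ) : Multiset ℝ :=
  (symbolHooks S).val.map (hookLen c k)

/-- `H_{ij}^ℓ(S)`, the set of hooks `(a,b,i,j)` of `S` with `a − b = ℓ`. -/
def Hij {d : ℕ} (S : Fin d → Finset ℕ) (i j : Fin d) (ℓ : ℕ) :
    Finset (ℕ × ℕ × Fin d × Fin d) :=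
  (symbolHooks S).filter fun z => z.2.2.1 = i ∧ z.2.2.2 = j ∧ z.1 - z.2.1 = ℓ

/-- The sign-modified length `h̄^{δ_S}` (on hooks of the balanced quotient), where
`x` records the cardinalities `x_i = |X_i|` of `S`, and `δ_S = (c_i + x_i k; k)`.
For a hook `z = (a,b,u,v)` with `ℓ = a − b`: relabelling so that `Δ = x_i − x_j ≥ 0`,
the sign is `+` if `z` lies in position `(i,j)`, or in position `(j,i)` with `ℓ > Δ`,
or in position `(j,i)` with `ℓ = Δ` and `i < j`; otherwise the sign is `−`. -/
noncomputable def signedLen {d : ℕ} (x : Fin d → ℕ) (c : Fin d → ℝ) (k : ℝ)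
    (z : ℕ × ℕ × Fin d × Fin d) : ℝ :=
  if x z.2.2.2 ≤ x z.2.2.1 then
    k * ((z.1 - z.2.1 : ℕ) : ℝ) + (c z.2.2.1 + (x z.2.2.1 : ℝ) * k)
      - (c z.2.2.2 + (x z.2.2.2 : ℝ) * k)
  else if x z.2.2.2 - x z.2.2.1 < z.1 - z.2.1 ∨
      (z.1 - z.2.1 = x z.2.2.2 - x z.2.2.1 ∧ (z.2.2.2 : ℕ) < (z.2.2.1 : ℕ)) then
    k * ((z.1 - z.2.1 : ℕ) : ℝ) + (c z.2.2.1 + (x z.2.2.1 : ℝ) * k)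
      - (c z.2.2.2 + (x z.2.2.2 : ℝ) * k)
  else
    -(k * ((z.1 - z.2.1 : ℕ) : ℝ) + (c z.2.2.1 + (x z.2.2.1 : ℝ) * k)
      - (c z.2.2.2 + (x z.2.2.2 : ℝ) * k))

/-- The permutation `σ_{d,ℓ,e}` of `ℕ`:
`σ(r(dℓ) + sd + t) = r(dℓ) + sd + ((t + re) mod d)`. -/
def twistFun (d ℓ e : ℕ) (n : ℕ) : ℕ :=
  d * ℓ * (n / (d * ℓ)) + d * (n % (d * ℓ) / d) + (n % d + n / (d * ℓ) * e) % d

/-- The `(ℓ,e)`-twist `σ(S) = s_d(σ(s_d⁻¹(S)))` of a `d`-symbol. -/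
def twistSymbol (d ℓ e : ℕ) (S : Fin d → Finset ℕ) : Fin d → Finset ℕ :=
  sd d ((sdInv d S).image (twistFun d ℓ e))

/-- `S_{*ℓ} = s_{dℓ}(s_d⁻¹(S))`. -/
def starSymbol (d ℓ : ℕ) (S : Fin d → Finset ℕ) : Fin (d * ℓ) → Finset ℕ :=
  sd (d * ℓ) (sdInv d S)

/-- The `ℓ`-core `C_{(ℓ)}(S) = s_d(s_{dℓ}⁻¹(C(S_{*ℓ})))` of a `d`-symbol. -/
def ellCore (d ℓ : ℕ) (S : Fin d → Finset ℕ) : Fin d → Finset ℕ :=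
  sd d (sdInv (d * ℓ) (coreSymbol (starSymbol d ℓ S)))

/-- The `(ℓ,e)`-core `C_{(ℓ,e)}(S) = s_d(σ⁻¹(s_d⁻¹(C_{(ℓ)}(σ(S)))))` of a
`d`-symbol; the inverse of `σ_{d,ℓ,e}` is `σ_{d,ℓ,d−e}`. -/
def elleCore (d ℓ e : ℕ) (S : Fin d → Finset ℕ) : Fin d → Finset ℕ :=
  sd d ((sdInv d (ellCore d ℓ (twistSymbol d ℓ e S))).image (twistFun d ℓ (d - e)))

theorem mem_shiftUp {X : Finset ℕ} {s x : ℕ} :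
    x ∈ shiftUp X s ↔ x < s ∨ (s ≤ x ∧ x - s ∈ X) := by
  simp only [shiftUp, Finset.mem_union, Finset.mem_image, Finset.mem_range]
  constructor
  · rintro (⟨a, ha, rfl⟩ | h)
    · exact Or.inr ⟨by omega, by simpa using ha⟩
    · exact Or.inl h
  · rintro (h | ⟨h, hx⟩)
    · exact Or.inr h
    · exact Or.inl ⟨x - s, hx, by omega⟩

theorem shiftUp_shiftUp (X : Finset ℕ) (s t : ℕ) :
    shiftUp (shiftUp X s) t = shiftUp X (s + t) := by
  ext x
  have h : x - t - s = x - (s + t) := by omega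
  simp only [mem_shiftUp, h]
  by_cases h1 : x - (s + t) ∈ X <;> simp only [h1, and_true, and_false, or_false] <;> omega

theorem shiftUp_range (m s : ℕ) : shiftUp (Finset.range m) s = Finset.range (m + s) := by
  ext x; simp only [mem_shiftUp, Finset.mem_range]; omega

theorem card_shiftUp (X : Finset ℕ) (s : ℕ) : (shiftUp X s).card = X.card + s := by
  rw [shiftUp, Finset.card_union_of_disjoint, Finset.card_image_of_injective _
    (add_left_injective s), Finset.card_range]
  rw [Finset.disjoint_left]
  intro x hx
  simp only [Finset.mem_image] at hx
  obtain ⟨a, -, rfl⟩ := hx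
  simp

theorem card_shiftUp_sdiff_shiftUp (A B : Finset ℕ) (s : ℕ) :
    (shiftUp A s \ shiftUp B s).card = (A \ B).card := by
  rw [← Finset.card_image_of_injective (A \ B) (add_left_injective s)]
  congr 1
  ext x
  simp only [Finset.mem_sdiff, mem_shiftUp, Finset.mem_image]
  constructor
  · rintro ⟨h1, h2⟩
    push Not at h2
    have hs : s ≤ x := h2.1
    refine ⟨x - s, ⟨?_, h2.2 hs⟩, by omega⟩
    rcases h1 with h1 | h1
    · omega
    · exact h1.2
  · rintro ⟨a, ⟨ha, hb⟩, rfl⟩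
    refine ⟨Or.inr ⟨by omega, by simpa using ha⟩, ?_⟩
    simpa using hb

/-- The parts of the partition of a β-set, zero parts included. -/
def betaParts (X : Finset ℕ) : Multiset ℕ :=
  X.val.map fun a => a - (X.filter (· < a)).card

theorem card_betaParts (X : Finset ℕ) : (betaParts X).card = X.card := by
  simp [betaParts]

theorem betaParts_insert {X : Finset ℕ} {a : ℕ} (h : ∀ x ∈ X, x < a) :
    betaParts (insert a X) = (a - X.card) ::ₘ betaParts X := by
  have ha : a ∉ X := fun hx => lt_irrefl _ (h a hx)
  rw [betaParts, Finset.insert_val_of_notMem ha, Multiset.map_cons]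
  congr 1
  · rw [Finset.filter_insert, if_neg (lt_irrefl _), Finset.filter_true_of_mem h]
  · refine Multiset.map_congr rfl fun b hb => ?_
    rw [Finset.filter_insert, if_neg (not_lt.mpr (h b hb).le)]

theorem card_le_of_forall_lt {X : Finset ℕ} {a : ℕ} (h : ∀ x ∈ X, x < a) : X.card ≤ a := by
  simpa using Finset.card_le_card (t := Finset.range a) fun x hx => Finset.mem_range.mpr (h x hx)

theorem le_of_mem_betaParts {X : Finset ℕ} {a k : ℕ} (h : ∀ x ∈ X, x < a)
    (hk : k ∈ betaParts X) : k ≤ a - X.card := by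
  obtain ⟨b, hb, rfl⟩ := Multiset.mem_map.mp hk
  have hsub : X ⊆ X.filter (· < b) ∪ Finset.Ico b a := by
    intro x hx
    have := h x hx
    simp only [Finset.mem_union, Finset.mem_filter, Finset.mem_Ico]
    by_cases hxb : x < b
    · exact Or.inl ⟨hx, hxb⟩
    · exact Or.inr ⟨by omega, this⟩
  have h1 := (Finset.card_le_card hsub).trans (Finset.card_union_le _ _)
  rw [Nat.card_Ico] at h1
  have h2 := h b hb
  have h3 : (X.filter (· < b)).card ≤ b :=
    card_le_of_forall_lt fun x hx => (Finset.mem_filter.mp hx).2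
  omega

theorem betaParts_injective : ∀ X Y : Finset ℕ, betaParts X = betaParts Y → X = Y := by
  intro X
  induction X using Finset.induction_on_max with
  | empty =>
    intro Y h
    have := congrArg Multiset.card h
    simpa [betaParts, eq_comm] using this
  | insert a X hX ih =>
    intro Y h
    have ha : a ∉ X := fun hx => lt_irrefl _ (hX a hx)
    have hcard : (insert a X).card = Y.card := by
      rw [← card_betaParts, h, card_betaParts]
    rw [Finset.card_insert_of_notMem ha] at hcard
    have hne : Y.Nonempty := Finset.card_pos.mp (by omega)
    have hmem := Y.max'_mem hne
    set b := Y.max' hne with hb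
    have hlt : ∀ y ∈ Y.erase b, y < b := fun y hy => Y.lt_max'_of_mem_erase_max' hne hy
    have hYc := Finset.card_erase_of_mem hmem
    have hY : Y = insert b (Y.erase b) := (Finset.insert_erase hmem).symm
    rw [hY, betaParts_insert hX, betaParts_insert hlt] at h
    have h1 : a - X.card ∈ (b - (Y.erase b).card) ::ₘ betaParts (Y.erase b) :=
      h ▸ Multiset.mem_cons_self _ _
    have h2 : b - (Y.erase b).card ∈ (a - X.card) ::ₘ betaParts X :=
      h ▸ Multiset.mem_cons_self _ _
    have h1' : a - X.card ≤ b - (Y.erase b).card := by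
      rcases Multiset.mem_cons.mp h1 with h1 | h1
      · exact h1.le
      · exact le_of_mem_betaParts hlt h1
    have h2' : b - (Y.erase b).card ≤ a - X.card := by
      rcases Multiset.mem_cons.mp h2 with h2 | h2
      · exact h2.le
      · exact le_of_mem_betaParts hX h2
    have h3 := card_le_of_forall_lt hX
    have h4 := card_le_of_forall_lt hlt
    have hab : a = b := by omega
    have heq : a - X.card = b - (Y.erase b).card := by omega
    rw [heq] at h
    rw [hY, ih _ (Multiset.cons_inj_right _ |>.mp h), hab]

theorem eq_of_partitionOf_eq {X Y : Finset ℕ} (hc : X.card = Y.card)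
    (h : partitionOf X = partitionOf Y) : X = Y := by
  apply betaParts_injective
  have hf : (betaParts X).filter (· ≠ 0) = (betaParts Y).filter (· ≠ 0) := h
  have hz : (betaParts X).filter (fun a => ¬ a ≠ 0) = (betaParts Y).filter (fun a => ¬ a ≠ 0) := by
    have hrep : ∀ Z : Finset ℕ, (betaParts Z).filter (fun a => ¬ a ≠ 0) =
        Multiset.replicate ((betaParts Z).filter (fun a => ¬ a ≠ 0)).card 0 := fun Z =>
      Multiset.eq_replicate_card.mpr fun b hb => by simpa using (Multiset.mem_filter.mp hb).2
    have hX := congrArg Multiset.card (Multiset.filter_add_not (· ≠ 0) (betaParts X))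
    have hY := congrArg Multiset.card (Multiset.filter_add_not (· ≠ 0) (betaParts Y))
    rw [Multiset.card_add, card_betaParts] at hX hY
    rw [hf] at hX
    rw [hrep X, hrep Y]
    congr 1
    omega
  rw [← Multiset.filter_add_not (· ≠ 0) (betaParts X),
    ← Multiset.filter_add_not (· ≠ 0) (betaParts Y), hf, hz]

theorem partitionOf_shiftUp (X : Finset ℕ) (s : ℕ) :
    partitionOf (shiftUp X s) = partitionOf X := by
  ext k
  rcases eq_or_ne k 0 with rfl | hk
  · rw [partitionOf, partitionOf, Multiset.count_filter_of_neg (by simp),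
      Multiset.count_filter_of_neg (by simp)]
  have hlow : ∀ x < s, ((shiftUp X s).filter (· < x)).card = x := by
    intro x hx
    have : (shiftUp X s).filter (· < x) = Finset.range x := by
      ext y
      simp only [Finset.mem_filter, mem_shiftUp, Finset.mem_range]
      exact ⟨fun h => h.2, fun h => ⟨Or.inl (by omega), h⟩⟩
    rw [this, Finset.card_range]
  have hhigh : ∀ x, ((shiftUp X s).filter (· < x + s)).card = (X.filter (· < x)).card + s := by
    intro x
    rw [← card_shiftUp]
    congr 1
    ext y
    simp only [Finset.mem_filter, mem_shiftUp]
    by_cases hy : y - s ∈ X <;>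
      simp only [hy, and_true, and_false, true_and, false_and, or_false] <;> omega
  rw [partitionOf, partitionOf, Multiset.count_filter_of_pos (p := (· ≠ 0)) hk,
    Multiset.count_filter_of_pos (p := (· ≠ 0)) hk, Multiset.count_map, Multiset.count_map]
  change ((shiftUp X s).filter _).card = (X.filter _).card
  rw [← Finset.card_image_of_injective (X.filter _) (add_left_injective s)]
  congr 1
  ext x
  simp only [Finset.mem_filter, Finset.mem_image]
  constructor
  · rintro ⟨hx, hkx⟩
    rcases mem_shiftUp.mp hx with h | ⟨h, h'⟩
    · rw [hlow x h] at hkx; omega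
    · refine ⟨x - s, ⟨h', ?_⟩, by omega⟩
      have := hhigh (x - s)
      rw [Nat.sub_add_cancel h] at this
      omega
  · rintro ⟨a, ⟨ha, hka⟩, rfl⟩
    refine ⟨mem_shiftUp.mpr (Or.inr ⟨by omega, by simpa using ha⟩), ?_⟩
    rw [hhigh]; omega

theorem IsBalancedQuotient.shiftUp_eq {n : ℕ} {T Y : Fin n → Finset ℕ}
    (h : IsBalancedQuotient T Y) (u : Fin n) :
    shiftUp (Y u) (T u).card = shiftUp (T u) (quotCard T) := by
  apply eq_of_partitionOf_eq
  · rw [card_shiftUp, card_shiftUp, (h u).1, add_comm]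
  · rw [partitionOf_shiftUp, partitionOf_shiftUp, (h u).2]

theorem mem_symbolHooks {d : ℕ} {S : Fin d → Finset ℕ} {z : ℕ × ℕ × Fin d × Fin d} :
    z ∈ symbolHooks S ↔ z.1 ∈ S z.2.2.1 ∧ z.2.1 ∉ S z.2.2.2 ∧
      (z.2.1 < z.1 ∨ (z.1 = z.2.1 ∧ z.2.2.2 < z.2.2.1)) := by
  simp only [symbolHooks, Finset.mem_filter, Finset.mem_product, Finset.mem_range,
    Finset.mem_univ, and_true, and_iff_right_iff_imp]
  rintro ⟨h1, -, h2⟩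
  have h3 : z.1 ≤ (S z.2.2.1).sup id := Finset.le_sup (f := id) h1
  have h4 : (S z.2.2.1).sup id ≤ Finset.univ.sup fun i => (S i).sup id :=
    Finset.le_sup (f := fun i => (S i).sup id) (Finset.mem_univ _)
  omega

theorem mem_betaHooks {X : Finset ℕ} {p : ℕ × ℕ} :
    p ∈ betaHooks X ↔ p.1 ∈ X ∧ p.2 ∉ X ∧ p.2 < p.1 := by
  simp only [betaHooks, Finset.mem_filter, Finset.mem_product, Finset.mem_range]
  constructor
  · tauto
  · rintro ⟨h1, h2, h3⟩
    have : p.1 ≤ X.sup id := Finset.le_sup (f := id) h1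
    exact ⟨⟨h1, by omega⟩, h3, h2⟩

/-- The number of hooks of `δ`-length `t`, for `δ = (c_0,…,c_{d−1};k)`. -/
noncomputable def hookCount {n : ℕ} (c : Fin n → ℝ) (k : ℝ) (S : Fin n → Finset ℕ) (t : ℝ) : ℕ :=
  ((symbolHooks S).filter fun z => hookLen c k z = t).card

/-- The number of hooks of `δ`-length `t` in position `(u,w)`. -/
noncomputable def hookCountAt {n : ℕ} (c : Fin n → ℝ) (k : ℝ) (S : Fin n → Finset ℕ) (t : ℝ)
    (u w : Fin n) : ℕ :=
  ((symbolHooks S).filter fun z => hookLen c k z = t ∧ z.2.2 = (u, w)).card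

theorem hookCount_eq_sum {n : ℕ} (c : Fin n → ℝ) (k : ℝ) (S : Fin n → Finset ℕ) (t : ℝ) :
    hookCount c k S t = ∑ u, ∑ w, hookCountAt c k S t u w := by
  rw [← Fintype.sum_prod_type', hookCount,
    Finset.card_eq_sum_card_fiberwise (f := fun z => z.2.2) (t := Finset.univ) (by simp)]
  refine Finset.sum_congr rfl fun uw _ => ?_
  rw [hookCountAt, Finset.filter_filter]

theorem hookLen_mem_position {n : ℕ} {c : Fin n → ℝ} {k : ℝ} {a b : ℕ} {u w : Fin n} :
    hookLen c k (a, b, u, w) = k * ((a - b : ℕ) : ℝ) + c u - c w := rfl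

theorem hookCountAt_eq_card_sdiff {n : ℕ} {c : Fin n → ℝ} {k : ℝ} (hk : 0 < k)
    (S : Fin n → Finset ℕ) {t : ℝ} {u w : Fin n} {m : ℕ} (hm : k * m + c u - c w = t)
    (hpos : 0 < m ∨ w < u) :
    hookCountAt c k S t u w = (S u \ shiftUp (S w) m).card := by
  have huniq : ∀ m' : ℕ, k * m' + c u - c w = t → m' = m := by
    intro m' h
    have : k * (m' : ℝ) = k * m := by linarith
    exact_mod_cast mul_left_cancel₀ hk.ne' this
  rw [hookCountAt]
  refine Finset.card_nbij' (fun z => z.1) (fun a => (a, a - m, u, w)) ?_ ?_ ?_ ?_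
  · rintro ⟨a, b, u', w'⟩ hz
    simp only [Finset.coe_filter, Set.mem_ofPred_eq, mem_symbolHooks, hookLen_mem_position,
      Prod.mk.injEq] at hz
    obtain ⟨⟨ha, hb, hab⟩, hlen, rfl, rfl⟩ := hz
    have := huniq _ hlen
    simp only [Finset.coe_sdiff, Set.mem_sdiff, Finset.mem_coe, mem_shiftUp]
    refine ⟨ha, ?_⟩
    rintro (h | ⟨h, h'⟩)
    · omega
    · rw [show a - m = b by omega] at h'
      exact hb h'
  · intro a ha
    simp only [Finset.coe_sdiff, Set.mem_sdiff, Finset.mem_coe, mem_shiftUp, not_or, not_and,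
      not_lt] at ha
    obtain ⟨ha, hma, hb⟩ := ha
    simp only [Finset.coe_filter, Set.mem_ofPred_eq, mem_symbolHooks, hookLen_mem_position, and_true]
    refine ⟨⟨ha, hb hma, ?_⟩, ?_⟩
    · rcases Nat.eq_zero_or_pos m with h0 | h0
      · exact Or.inr ⟨by omega, hpos.resolve_left (by omega)⟩
      · exact Or.inl (by omega)
    · rw [show a - (a - m) = m by omega]; exact hm
  · rintro ⟨a, b, u', w'⟩ hz
    simp only [Finset.coe_filter, Set.mem_ofPred_eq, mem_symbolHooks, hookLen_mem_position,
      Prod.mk.injEq] at hz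
    obtain ⟨⟨ha, hb, hab⟩, hlen, rfl, rfl⟩ := hz
    have := huniq _ hlen
    simp only [Prod.mk.injEq, and_true, true_and]
    omega
  · intro a _; rfl

theorem hookCountAt_eq_zero {n : ℕ} {c : Fin n → ℝ} {k : ℝ}
    (S : Fin n → Finset ℕ) {t : ℝ} {u w : Fin n}
    (h : ∀ m : ℕ, k * m + c u - c w = t → ¬ (0 < m ∨ w < u)) :
    hookCountAt c k S t u w = 0 := by
  rw [hookCountAt, Finset.card_eq_zero, Finset.filter_eq_empty_iff]
  rintro ⟨a, b, u', w'⟩ hz ⟨hlen, huw⟩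
  simp only [Prod.mk.injEq] at huw
  obtain ⟨rfl, rfl⟩ := huw
  obtain ⟨-, -, hab⟩ := mem_symbolHooks.mp hz
  refine h _ hlen ?_
  rcases hab with hab | hab
  · exact Or.inl (Nat.sub_pos_of_lt hab)
  · exact Or.inr hab.2

theorem hookCountAt_eq_add {n : ℕ} {T Y : Fin n → Finset ℕ} (hY : IsBalancedQuotient T Y)
    {c : Fin n → ℝ} (hc : Monotone c) {k : ℝ} (hk : 0 < k) (hck : ∀ u w, c u - c w < k)
    {t : ℝ} (ht : 0 < t) (u w : Fin n) :
    hookCountAt c k T t u w =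
      hookCountAt (fun i => c i + k * (T i).card) k Y t u w +
      hookCountAt (fun i => c i + k * (T i).card) k Y (-t) w u +
      hookCountAt c k (coreSymbol T) t u w := by
  by_cases hex : ∃ m : ℤ, k * m + c u - c w = t
  swap
  · push Not at hex
    rw [hookCountAt_eq_zero, hookCountAt_eq_zero, hookCountAt_eq_zero, hookCountAt_eq_zero]
    · exact fun m hm => (hex m (by exact_mod_cast hm)).elim
    · refine fun m hm => (hex ((T u).card - (T w).card - m) ?_).elim
      push_cast; linarith
    · refine fun m hm => (hex ((T u).card - (T w).card + m) ?_).elim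
      push_cast; linarith
    · exact fun m hm => (hex m (by exact_mod_cast hm)).elim
  obtain ⟨m, hm⟩ := hex
  have hm0 : 0 ≤ m := by
    have h1 : k * (-1 : ℝ) < k * m := by linarith [hck u w]
    have h2 : (-1 : ℝ) < m := lt_of_mul_lt_mul_left h1 hk.le
    have h3 : (-1 : ℤ) < m := by exact_mod_cast h2
    omega
  lift m to ℕ using hm0
  rw [Int.cast_natCast] at hm
  have hpos : 0 < m ∨ w < u := by
    rcases Nat.eq_zero_or_pos m with rfl | h0
    · right
      by_contra hcon
      have := hc (not_lt.mp hcon)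
      push_cast at hm
      linarith
    · exact Or.inl h0
  have hcancel : ∀ p q : ℤ, k * p = k * q → p = q := fun p q h => by
    exact_mod_cast mul_left_cancel₀ hk.ne' h
  have hplus : ∀ m' : ℕ, k * m' + (c u + k * (T u).card) - (c w + k * (T w).card) = t →
      (m' : ℤ) + (T u).card = m + (T w).card := fun m' h => by
    apply hcancel; push_cast; linarith
  have hminus : ∀ m' : ℕ, k * m' + (c w + k * (T w).card) - (c u + k * (T u).card) = -t →
      (m' : ℤ) + m + (T w).card = (T u).card := fun m' h => by
    apply hcancel; push_cast; linarith
  have hsdiff : (shiftUp (T u) (quotCard T) \ shiftUp (T w) (quotCard T + m)).card =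
      (T u \ shiftUp (T w) m).card := by
    rw [add_comm, ← shiftUp_shiftUp, card_shiftUp_sdiff_shiftUp]
  have hsdiff' : (shiftUp (T w) (quotCard T + m) \ shiftUp (T u) (quotCard T)).card =
      (shiftUp (T w) m \ T u).card := by
    rw [add_comm, ← shiftUp_shiftUp, card_shiftUp_sdiff_shiftUp]
  have hcomm := Finset.card_sdiff_add_card (T u) (shiftUp (T w) m)
  have hcomm' := Finset.card_sdiff_add_card (shiftUp (T w) m) (T u)
  rw [Finset.union_comm, card_shiftUp] at hcomm
  have hcore : hookCountAt c k (coreSymbol T) t u w = (T u).card - ((T w).card + m) := by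
    rw [hookCountAt_eq_card_sdiff hk _ hm hpos, coreSymbol, coreSymbol, shiftUp_range]
    rw [Finset.card_sdiff, Finset.range_inter_range, Finset.card_range, Finset.card_range]
    omega
  have hYu := hY.shiftUp_eq u
  have hYw := hY.shiftUp_eq w
  rw [hcore, hookCountAt_eq_card_sdiff hk _ hm hpos]
  have hQ : ∀ h : ℕ, h + (T u).card = m + (T w).card →
      (Y u \ shiftUp (Y w) h).card = (T u \ shiftUp (T w) m).card := by
    intro h hh
    rw [← card_shiftUp_sdiff_shiftUp _ _ (T u).card, shiftUp_shiftUp, hh, add_comm m,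
      ← shiftUp_shiftUp, hYu, hYw, shiftUp_shiftUp, hsdiff]
  have hQ' : ∀ h : ℕ, h + m + (T w).card = (T u).card →
      (Y w \ shiftUp (Y u) h).card = (shiftUp (T w) m \ T u).card := by
    intro h hh
    rw [← card_shiftUp_sdiff_shiftUp _ _ ((T w).card + m), shiftUp_shiftUp,
      show h + ((T w).card + m) = (T u).card by omega,
      ← shiftUp_shiftUp, hYu, hYw, shiftUp_shiftUp, hsdiff']
  by_cases hcase : (T u).card < m + (T w).card ∨ ((T u).card = m + (T w).card ∧ w < u)
  · rw [hookCountAt_eq_card_sdiff hk Y (t := t) (m := m + (T w).card - (T u).card),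
      hookCountAt_eq_zero, hQ]
    · omega
    · omega
    · intro m' h'
      have := hminus m' h'
      rintro (h0 | h0)
      · omega
      · exact absurd h0 (not_lt.mpr (hcase.resolve_left (by omega)).2.le)
    · rw [Nat.cast_sub (by omega)]
      push_cast
      linarith
    · rcases hcase with h | h
      · exact Or.inl (by omega)
      · exact Or.inr h.2
  · rw [not_or, not_and, not_lt, not_lt] at hcase
    rw [hookCountAt_eq_zero,
      hookCountAt_eq_card_sdiff hk Y (t := -t) (m := (T u).card - (m + (T w).card)), hQ']
    · omega
    · omega
    · rw [Nat.cast_sub (by omega)]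
      push_cast
      linarith
    · rcases hcase.1.lt_or_eq with h | h
      · exact Or.inl (by omega)
      · refine Or.inr (lt_of_le_of_ne (hcase.2 h.symm) ?_)
        rintro rfl
        have hm1 : m = 0 := by omega
        subst hm1
        push_cast at hm
        linarith
    · intro m' h'
      have := hplus m' h'
      rintro (h0 | h0)
      · omega
      · exact absurd h0 (not_lt.mpr (hcase.2 (by omega)))

theorem hookCount_eq_add {n : ℕ} {T Y : Fin n → Finset ℕ} (hY : IsBalancedQuotient T Y)
    {c : Fin n → ℝ} (hc : Monotone c) {k : ℝ} (hk : 0 < k) (hck : ∀ u w, c u - c w < k)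
    {t : ℝ} (ht : 0 < t) :
    hookCount c k T t =
      hookCount (fun i => c i + k * (T i).card) k Y t +
      hookCount (fun i => c i + k * (T i).card) k Y (-t) +
      hookCount c k (coreSymbol T) t := by
  simp only [hookCount_eq_sum]
  rw [Finset.sum_comm (f := fun u w =>
    hookCountAt (fun i => c i + k * ((T i).card : ℝ)) k Y (-t) u w)]
  simp only [← Finset.sum_add_distrib]
  exact Finset.sum_congr rfl fun u _ => Finset.sum_congr rfl fun w _ =>
    hookCountAt_eq_add hY hc hk hck ht u w

theorem mem_sd {d : ℕ} {X : Finset ℕ} {i : Fin d} {k : ℕ} :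
    k ∈ sd d X i ↔ (i : ℕ) + k * d ∈ X := by
  have hd : 0 < d := i.pos
  simp only [sd, Finset.mem_image, Finset.mem_filter]
  constructor
  · rintro ⟨a, ⟨ha, hai⟩, rfl⟩
    rwa [← hai, Nat.mod_add_div']
  · intro h
    refine ⟨_, ⟨h, ?_⟩, ?_⟩
    · rw [Nat.add_mul_mod_self_right, Nat.mod_eq_of_lt i.2]
    · rw [Nat.add_mul_div_right _ _ hd, Nat.div_eq_of_lt i.2, zero_add]

theorem mem_sdInv {d : ℕ} {S : Fin d → Finset ℕ} {i : Fin d} {k : ℕ} :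
    (i : ℕ) + k * d ∈ sdInv d S ↔ k ∈ S i := by
  have hd : 0 < d := i.pos
  simp only [sdInv, Finset.mem_biUnion, Finset.mem_univ, true_and, Finset.mem_image]
  constructor
  · rintro ⟨j, b, hb, h⟩
    have hmod := congrArg (· % d) h
    have hdiv := congrArg (· / d) h
    simp only [Nat.add_mul_mod_self_right, Nat.mod_eq_of_lt i.2, Nat.mod_eq_of_lt j.2] at hmod
    simp only [Nat.add_mul_div_right _ _ hd, Nat.div_eq_of_lt i.2, Nat.div_eq_of_lt j.2,
      zero_add] at hdiv
    rw [← hdiv, ← Fin.ext hmod]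
    exact hb
  · exact fun h => ⟨i, k, h, rfl⟩

theorem sd_sdInv (d : ℕ) (S : Fin d → Finset ℕ) : sd d (sdInv d S) = S := by
  ext i k
  rw [mem_sd, mem_sdInv]

theorem sdInv_sd {d : ℕ} (hd : 0 < d) (X : Finset ℕ) : sdInv d (sd d X) = X := by
  ext x
  have h := mem_sdInv (S := sd d X) (i := ⟨x % d, Nat.mod_lt _ hd⟩) (k := x / d)
  rw [mem_sd] at h
  simpa only [Nat.mod_add_div'] using h

theorem add_mul_lt_add_mul_iff {d a b i j : ℕ} (hi : i < d) (hj : j < d) :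
    j + b * d < i + a * d ↔ b < a ∨ (a = b ∧ j < i) := by
  rcases lt_trichotomy a b with h | rfl | h
  · have : (a + 1) * d ≤ b * d := Nat.mul_le_mul_right _ h
    rw [add_mul, one_mul] at this
    omega
  · omega
  · have : (b + 1) * d ≤ a * d := Nat.mul_le_mul_right _ h
    rw [add_mul, one_mul] at this
    omega

/-- The hooks of `s_d(X)` correspond to the hooks of the β-set `X`. -/
theorem card_filter_symbolHooks_sd {d : ℕ} (hd : 0 < d) (X : Finset ℕ) (R : ℕ → ℕ → Prop)
    [∀ p q, Decidable (R p q)] :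
    ((symbolHooks (sd d X)).filter
        fun z => R ((z.2.2.1 : ℕ) + z.1 * d) ((z.2.2.2 : ℕ) + z.2.1 * d)).card =
      ((betaHooks X).filter fun p => R p.1 p.2).card := by
  refine Finset.card_nbij'
    (fun z => ((z.2.2.1 : ℕ) + z.1 * d, (z.2.2.2 : ℕ) + z.2.1 * d))
    (fun p => (p.1 / d, p.2 / d, ⟨p.1 % d, Nat.mod_lt _ hd⟩, ⟨p.2 % d, Nat.mod_lt _ hd⟩))
    ?_ ?_ ?_ ?_
  · rintro ⟨a, b, i, j⟩ hz
    simp only [Finset.coe_filter, Set.mem_ofPred_eq, mem_symbolHooks, mem_sd, mem_betaHooks] at hz ⊢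
    rw [add_mul_lt_add_mul_iff i.2 j.2]
    exact hz
  · rintro ⟨p, q⟩ hz
    simp only [Finset.coe_filter, Set.mem_ofPred_eq, mem_symbolHooks, mem_sd, mem_betaHooks,
      Nat.mod_add_div', Fin.mk_lt_mk] at hz ⊢
    rw [← add_mul_lt_add_mul_iff (Nat.mod_lt p hd) (Nat.mod_lt q hd), Nat.mod_add_div',
      Nat.mod_add_div']
    exact hz
  · rintro ⟨a, b, i, j⟩ -
    simp only [Nat.add_mul_div_right _ _ hd, Nat.div_eq_of_lt i.2, Nat.div_eq_of_lt j.2,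
      Nat.add_mul_mod_self_right, Nat.mod_eq_of_lt i.2, Nat.mod_eq_of_lt j.2, zero_add, Fin.eta]
  · rintro ⟨p, q⟩ -
    simp only [Nat.mod_add_div']

theorem twistFun_eq (d ℓ e n : ℕ) :
    twistFun d ℓ e n = (n % d + n / d / ℓ * e) % d + d * (n / d) := by
  rw [twistFun, Nat.mod_mul_right_div_self, ← Nat.div_div_eq_div_mul, mul_assoc, ← mul_add,
    Nat.div_add_mod, add_comm]

theorem twistFun_div {d : ℕ} (hd : 0 < d) (ℓ e n : ℕ) : twistFun d ℓ e n / d = n / d := by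
  rw [twistFun_eq, Nat.add_mul_div_left _ _ hd, Nat.div_eq_of_lt (Nat.mod_lt _ hd), zero_add]

theorem twistFun_mod (d ℓ e n : ℕ) :
    twistFun d ℓ e n % d = (n % d + n / d / ℓ * e) % d := by
  rw [twistFun_eq, Nat.add_mul_mod_self_left, Nat.mod_mod]

theorem twistFun_twistFun {d : ℕ} (hd : 0 < d) (ℓ : ℕ) {e f : ℕ} (hef : e + f = d) (n : ℕ) :
    twistFun d ℓ f (twistFun d ℓ e n) = n := by
  rw [twistFun_eq d ℓ f, twistFun_div hd, twistFun_mod, Nat.mod_add_mod, add_assoc, ← mul_add,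
    hef, Nat.add_mul_mod_self_right, Nat.mod_mod, Nat.mod_add_div]

theorem card_filter_betaHooks_image {f g : ℕ → ℕ} (hgf : ∀ n, g (f n) = n)
    (hfg : ∀ n, f (g n) = n) (X : Finset ℕ) (R : ℕ → ℕ → Prop) [∀ p q, Decidable (R p q)]
    (hR : ∀ p q, R p q → q < p) (hRf : ∀ p q, R (f p) (f q) ↔ R p q) :
    ((betaHooks (X.image f)).filter fun p => R p.1 p.2).card =
      ((betaHooks X).filter fun p => R p.1 p.2).card := by
  have hmem : ∀ p, f p ∈ X.image f ↔ p ∈ X := fun p =>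
    (Function.LeftInverse.injective hgf).mem_finset_image
  symm
  refine Finset.card_nbij' (fun p => (f p.1, f p.2)) (fun p => (g p.1, g p.2)) ?_ ?_ ?_ ?_
  · rintro ⟨p, q⟩ h
    simp only [Finset.coe_filter, Set.mem_ofPred_eq, mem_betaHooks, hmem, hRf] at h ⊢
    exact ⟨⟨h.1.1, h.1.2.1, hR _ _ ((hRf p q).mpr h.2)⟩, h.2⟩
  · rintro ⟨p, q⟩ h
    simp only [Finset.coe_filter, Set.mem_ofPred_eq, mem_betaHooks] at h ⊢
    rw [← hmem, ← hmem, ← hRf, hfg, hfg]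
    exact ⟨⟨h.1.1, h.1.2.1, hR _ _ ((hRf _ _).mp (by simpa only [hfg] using h.2))⟩, h.2⟩
  · rintro ⟨p, q⟩ -
    simp only [hgf]
  · rintro ⟨p, q⟩ -
    simp only [hfg]

theorem add_mul_div_self_mul {d ℓ : ℕ} (hd : 0 < d) (u a : ℕ) :
    (u + a * (d * ℓ)) / d = u / d + ℓ * a := by
  rw [show u + a * (d * ℓ) = u + d * (ℓ * a) by ring, Nat.add_mul_div_left _ _ hd]

/-- Long hooks of `s_d(X)` of length `t` correspond to hooks of `s_{dℓ}(σ(X))` of `δ`-length `t`,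
where `δ` has multiplier `ℓ` and entry `⌊u/d⌋` in position `u`. -/
theorem card_long_hooks_eq_hookCount {d : ℕ} (hd : 0 < d) {ℓ : ℕ} (hℓ : 0 < ℓ) {e : ℕ}
    (he : e ≤ d) (X : Finset ℕ) {t : ℝ} (ht : 0 < t) :
    ((symbolHooks (sd d X)).filter
        fun z => z.2.1 < z.1 ∧ t = ((z.1 - z.2.1 : ℕ) : ℝ)).card =
      hookCount (fun u : Fin (d * ℓ) => (((u : ℕ) / d : ℕ) : ℝ)) ℓ
        (sd (d * ℓ) (X.image (twistFun d ℓ e))) t := by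
  classical
  let R : ℕ → ℕ → Prop := fun p q => ((p / d : ℕ) : ℝ) = (q / d : ℕ) + t
  have hR : ∀ p q, R p q → q < p := by
    intro p q h
    have h' : ((q / d : ℕ) : ℝ) < (p / d : ℕ) := by
      simp only [R] at h; linarith
    by_contra hcon
    exact absurd (Nat.div_le_div_right (c := d) (not_lt.mp hcon))
      (not_le.mpr (by exact_mod_cast h'))
  have h1 := card_filter_symbolHooks_sd hd X R
  have h2 := card_filter_symbolHooks_sd (Nat.mul_pos hd hℓ) (X.image (twistFun d ℓ e)) R
  rw [card_filter_betaHooks_image (twistFun_twistFun hd ℓ (Nat.add_sub_of_le he))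
    (twistFun_twistFun hd ℓ (Nat.sub_add_cancel he)) X R hR
    (fun p q => by simp only [R, twistFun_div hd]), ← h1] at h2
  refine Eq.trans ?_ (h2.symm.trans ?_)
  · congr 1
    refine Finset.filter_congr ?_
    rintro ⟨a, b, i, j⟩ -
    simp only [R, Nat.add_mul_div_right _ _ hd, Nat.div_eq_of_lt i.2, Nat.div_eq_of_lt j.2,
      zero_add]
    constructor
    · rintro ⟨h, h'⟩
      rw [h', Nat.cast_sub h.le]; ring
    · intro h
      have hab : b < a := by
        have : (b : ℝ) < a := by linarith
        exact_mod_cast this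
      refine ⟨hab, ?_⟩
      rw [Nat.cast_sub hab.le]; linarith
  · rw [hookCount]
    congr 1
    refine Finset.filter_congr ?_
    rintro ⟨a, b, i, j⟩ hz
    have hba : b ≤ a := by
      rcases (mem_symbolHooks.mp hz).2.2 with h | h
      · exact h.le
      · exact h.1.ge
    simp only [R, add_mul_div_self_mul hd, hookLen_mem_position]
    rw [Nat.cast_sub hba]
    push_cast
    constructor <;> intro h <;> linarith

theorem starSymbol_twistSymbol {d : ℕ} (hd : 0 < d) (ℓ e : ℕ) (S : Fin d → Finset ℕ) :
    starSymbol d ℓ (twistSymbol d ℓ e S) =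
      sd (d * ℓ) ((sdInv d S).image (twistFun d ℓ e)) := by
  rw [starSymbol, twistSymbol, sdInv_sd hd]

theorem card_starSymbol {d : ℕ} (hd : 0 < d) {ℓ : ℕ} (S : Fin d → Finset ℕ)
    (u : Fin (d * ℓ)) :
    ((S ⟨(u : ℕ) % d, Nat.mod_lt _ hd⟩).filter (fun a => a % ℓ = (u : ℕ) / d)).card =
      (starSymbol d ℓ S u).card := by
  have hu : (u : ℕ) / d < ℓ := Nat.div_lt_of_lt_mul u.2
  have hℓ : 0 < ℓ := (Nat.zero_le _).trans_lt hu
  have key : ∀ a : ℕ, a ∈ starSymbol d ℓ S u ↔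
      (u : ℕ) / d + ℓ * a ∈ S ⟨(u : ℕ) % d, Nat.mod_lt _ hd⟩ := by
    intro a
    rw [starSymbol, mem_sd, ← mem_sdInv]
    have : (u : ℕ) % d + ((u : ℕ) / d + ℓ * a) * d = (u : ℕ) + a * (d * ℓ) := by
      conv_rhs => rw [← Nat.mod_add_div (u : ℕ) d]
      ring
    rw [← this]
  refine Finset.card_nbij' (fun a => a / ℓ) (fun a => (u : ℕ) / d + ℓ * a) ?_ ?_ ?_ ?_
  · intro a ha
    simp only [Finset.coe_filter, Set.mem_ofPred_eq] at ha
    rw [Finset.mem_coe, key, ← ha.2, Nat.mod_add_div]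
    exact ha.1
  · intro a ha
    simp only [Finset.coe_filter, Set.mem_ofPred_eq]
    refine ⟨(key a).mp ha, ?_⟩
    rw [Nat.add_mul_mod_self_left, Nat.mod_eq_of_lt hu]
  · intro a ha
    simp only [Finset.coe_filter, Set.mem_ofPred_eq] at ha
    change (u : ℕ) / d + ℓ * (a / ℓ) = a
    rw [← ha.2, Nat.mod_add_div]
  · intro a _
    change ((u : ℕ) / d + ℓ * a) / ℓ = a
    rw [Nat.add_mul_div_left _ _ hℓ, Nat.div_eq_of_lt hu, zero_add]

theorem count_map_long_hooks {d : ℕ} (S : Fin d → Finset ℕ) (t : ℝ) :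
    Multiset.count t (((symbolHooks S).filter (fun z => z.2.1 < z.1)).val.map
        (fun z => ((z.1 - z.2.1 : ℕ) : ℝ))) =
      ((symbolHooks S).filter fun z => z.2.1 < z.1 ∧ t = ((z.1 - z.2.1 : ℕ) : ℝ)).card := by
  rw [Multiset.count_map, ← Finset.filter_filter]
  rfl

theorem count_abs_hookLens {n : ℕ} (c : Fin n → ℝ) (k : ℝ) (S : Fin n → Finset ℕ) {t : ℝ}
    (ht : 0 < t) :
    Multiset.count t (Multiset.filter (fun r => r ≠ 0) ((hookLens c k S).map (fun r => |r|))) =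
      hookCount c k S t + hookCount c k S (-t) := by
  rw [Multiset.count_filter_of_pos (p := (· ≠ 0)) ht.ne', hookLens, Multiset.map_map,
    Multiset.count_map]
  rw [hookCount, hookCount, ← Finset.card_union_of_disjoint, ← Finset.filter_or]
  · change ((symbolHooks S).filter _).card = _
    congr 1
    refine Finset.filter_congr fun z _ => ?_
    rw [Function.comp_apply, eq_comm, abs_eq ht.le]
  · rw [Finset.disjoint_filter]
    intro z _ h1 h2
    linarith

/-- `𝓗_{>0}(S) = abs(𝓗_{>0}^δ(Q)) ∪ 𝓗_{>0}(C)`: the multiset of lengths of the long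
hooks of `S` equals the multiset of the nonzero absolute values of the `δ`-lengths
of the hooks of the balanced `(ℓ,e)`-quotient `Q = Q(σ(S)_{*ℓ})`, together with the
multiset of lengths of the long hooks of the `(ℓ,e)`-core `C = C_{(ℓ,e)}(S)`.
Here `δ = δ_{ℓ,σ(S)}` has multiplier `ℓ` and entry `s + ℓ·x_{i,s}` in position
`sd + i`, `x_{i,s}` being the number of elements of the `i`-th β-set of `σ(S)`
congruent to `s` modulo `ℓ`. -/
theorem long_hooks_eq_abs_quot_add_core (d : ℕ) (hd : 0 < d) (ℓ : ℕ) (hℓ : 0 < ℓ)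
    (e : ℕ) (he : e < d) (S : Fin d → Finset ℕ)
    (Y : Fin (d * ℓ) → Finset ℕ)
    (hY : IsBalancedQuotient (starSymbol d ℓ (twistSymbol d ℓ e S)) Y) :
    ((symbolHooks S).filter (fun z => z.2.1 < z.1)).val.map
        (fun z => ((z.1 - z.2.1 : ℕ) : ℝ)) =
      Multiset.filter (fun r => r ≠ 0)
          ((hookLens
              (fun i' : Fin (d * ℓ) =>
                (((i' : ℕ) / d : ℕ) : ℝ) +
                  (ℓ : ℝ) *
                    (((twistSymbol d ℓ e S ⟨(i' : ℕ) % d, Nat.mod_lt _ hd⟩).filter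
                        (fun a => a % ℓ = (i' : ℕ) / d)).card : ℝ))
              (ℓ : ℝ) Y).map (fun r => |r|)) +
        ((symbolHooks (elleCore d ℓ e S)).filter (fun z => z.2.1 < z.1)).val.map
          (fun z => ((z.1 - z.2.1 : ℕ) : ℝ)) := by
  set σS := (sdInv d S).image (twistFun d ℓ e) with hσS
  set T := starSymbol d ℓ (twistSymbol d ℓ e S) with hT
  have hTeq : T = sd (d * ℓ) σS := starSymbol_twistSymbol hd ℓ e S
  simp only [card_starSymbol hd (twistSymbol d ℓ e S)]
  rw [← hT]
  ext t
  rcases le_or_gt t 0 with ht | ht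
  · have hlong : ∀ S' : Fin d → Finset ℕ, Multiset.count t
        (((symbolHooks S').filter (fun z => z.2.1 < z.1)).val.map
          (fun z => ((z.1 - z.2.1 : ℕ) : ℝ))) = 0 := by
      intro S'
      rw [count_map_long_hooks, Finset.card_eq_zero, Finset.filter_eq_empty_iff]
      rintro z - ⟨h1, h2⟩
      have : (0 : ℝ) < ((z.1 - z.2.1 : ℕ) : ℝ) := by exact_mod_cast Nat.sub_pos_of_lt h1
      linarith
    rw [Multiset.count_add, hlong, hlong, add_zero, eq_comm]
    refine Multiset.count_eq_zero_of_notMem fun h => ?_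
    obtain ⟨h1, h2⟩ := Multiset.mem_filter.mp h
    obtain ⟨r, -, rfl⟩ := Multiset.mem_map.mp h1
    exact h2 (le_antisymm ht (abs_nonneg r))
  rw [Multiset.count_add, count_map_long_hooks, count_map_long_hooks, count_abs_hookLens _ _ _ ht]
  have hcore : elleCore d ℓ e S =
      sd d ((sdInv (d * ℓ) (coreSymbol T)).image (twistFun d ℓ (d - e))) := by
    rw [elleCore, ellCore, sdInv_sd hd]
  have himage : ((sdInv (d * ℓ) (coreSymbol T)).image (twistFun d ℓ (d - e))).image
      (twistFun d ℓ e) = sdInv (d * ℓ) (coreSymbol T) := by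
    rw [Finset.image_image, show twistFun d ℓ e ∘ twistFun d ℓ (d - e) = id from
      funext fun m => twistFun_twistFun hd ℓ (Nat.sub_add_cancel he.le) m, Finset.image_id]
  have hS := card_long_hooks_eq_hookCount hd hℓ he.le (sdInv d S) ht
  have hC := card_long_hooks_eq_hookCount hd hℓ he.le
    ((sdInv (d * ℓ) (coreSymbol T)).image (twistFun d ℓ (d - e))) ht
  rw [himage, sd_sdInv, ← hcore] at hC
  rw [sd_sdInv, ← hσS, ← hTeq] at hS
  rw [hS, hC]
  refine hookCount_eq_add hY (fun u w huw => ?_) (by exact_mod_cast hℓ) (fun u w => ?_) ht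
  · exact_mod_cast Nat.div_le_div_right (c := d) (Fin.le_def.mp huw)
  · have h1 : (((u : ℕ) / d : ℕ) : ℝ) < ℓ := by exact_mod_cast Nat.div_lt_of_lt_mul u.2
    have h2 : (0 : ℝ) ≤ (((w : ℕ) / d : ℕ) : ℝ) := Nat.cast_nonneg _
    linarith
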